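/- Let n ≥ 1 and let β^(i) ∈ C²(A, A^(⊗(i+1))) for 1 ≤ i ≤ n satisfy, for every 1 ≤ m ≤ n, the truncated Maurer–Cartan equation b(β^(m)) = Σ_{i+j=m, i,j≥1} β^(i) ∨ β^(j). Then the next obstruction Σ_{i+j=n+1, i,j≥1} β^(i) ∨ β^(j) ∈ C³(A, A^(⊗(n+2))) is a Hochschild 3-cocycle: b(Σ_{i+j=n+1, i,j≥1} β^(i) ∨ β^(j)) = 0. -/

import Mathlib

open scoped TensorProduct

noncomputable section

/-- Tuple obtained by concatenating `x` and `y` while multiplying the two adjacent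
boundary components: `(x₀,…,x_{a-1}, x_a·y₀, y₁,…,y_b)`. -/
def mergeTuple {A : Type} [Mul A] {a b : ℕ} (x : Fin (a + 1) → A) (y : Fin (b + 1) → A) :
    Fin (a + b + 1) → A :=
  fun i =>
    if h : i.1 < a then x ⟨i.1, by omega⟩
    else if h' : i.1 = a then x (Fin.last a) * y 0
    else y ⟨i.1 - a, by have := i.2; omega⟩

/-- Plain concatenation of tuples. -/
def appendTuple {A : Type} {a b : ℕ} (x : Fin (a + 1) → A) (y : Fin (b + 1) → A) :
    Fin (a + b + 2) → A :=
  fun i =>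
    if h : i.1 ≤ a then x ⟨i.1, by omega⟩
    else y ⟨i.1 - (a + 1), by have := i.2; omega⟩

/-- The tuple `(a₁,…,aᵢ·a_{i+1},…,a_{n+2})` (0-indexed: multiply entries `i` and `i+1`). -/
def mulArg {A : Type} [Mul A] {n : ℕ} (a : Fin (n + 2) → A) (i : Fin (n + 1)) :
    Fin (n + 1) → A :=
  fun j =>
    if j.1 < i.1 then a ⟨j.1, by have := j.2; omega⟩
    else if j.1 = i.1 then a ⟨j.1, by have := j.2; omega⟩ * a ⟨j.1 + 1, by have := j.2; omega⟩
    else a ⟨j.1 + 1, by have := j.2; omega⟩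

/-- The tower `⊕_{m ≥ 1} A^{⊗m}` of tensor powers of `A` (that is, the positive part of
the free product `A_t = A ∗ k[t]`, via `A^{⊗m} ∋ a₁⊗⋯⊗a_m ↔ a₁ t a₂ t ⋯ t a_m`),
together with:
* pure tensors `τ` and a `model` identification of the degree-`(m+1)` part with
  `A^{⊗(m+1)}`, pinning the object down;
* the concatenation product `conc` and the merge product
  `mrg((x₁⊗⋯⊗x_a), (y₁⊗⋯⊗y_b)) = x₁⊗⋯⊗(x_a·y₁)⊗⋯⊗y_b`;
* insertion operators `headIns`/`tailIns` extending a multilinear map `f` to an operator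
  `f^{[i,j]}` consuming the first (resp. last) tensor component together with given
  explicit arguments;
* the operations `⊢`, `⊣`, `∪` on Hochschild cochains `C^p(A, A^{⊗q})` (a cochain being
  a multilinear map `A^p → ⊕_m A^{⊗m}`, with values in a fixed degree), and the
  Hochschild differential `hoch`, all characterized by their defining formulas. -/
structure TensorTower (k : Type) [Field k] (A : Type) [Ring A] [Algebra k A] : Type 1 where
  U : Type
  [acg : AddCommGroup U]
  [mod : Module k U]
  Tdeg : ℕ → Submodule k U
  grading : DirectSum.IsInternal Tdeg
  Tdeg_zero : Tdeg 0 = ⊥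
  τ : ∀ m : ℕ, MultilinearMap k (fun _ : Fin (m + 1) => A) U
  τ_mem : ∀ (m : ℕ) (x : Fin (m + 1) → A), τ m x ∈ Tdeg (m + 1)
  model : ∀ m : ℕ, (TensorPower k (m + 1) A) ≃ₗ[k] (Tdeg (m + 1))
  model_eq : ∀ (m : ℕ) (x : Fin (m + 1) → A),
    ((model m (PiTensorProduct.tprod k x)) : U) = τ m x
  conc : U →ₗ[k] U →ₗ[k] U
  conc_eq : ∀ {a b : ℕ} (x : Fin (a + 1) → A) (y : Fin (b + 1) → A),
    conc (τ a x) (τ b y) = τ (a + b + 1) (appendTuple x y)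
  mrg : U →ₗ[k] U →ₗ[k] U
  mrg_eq : ∀ {a b : ℕ} (x : Fin (a + 1) → A) (y : Fin (b + 1) → A),
    mrg (τ a x) (τ b y) = τ (a + b) (mergeTuple x y)
  headIns : ∀ {p : ℕ},
    (MultilinearMap k (fun _ : Fin (p + 1) => A) U) → (Fin p → A) → (U →ₗ[k] U)
  headIns_eq : ∀ {p : ℕ} (f : MultilinearMap k (fun _ : Fin (p + 1) => A) U)
      (v : Fin p → A) {N : ℕ} (x : Fin (N + 2) → A),
    headIns f v (τ (N + 1) x) = conc (f (Fin.snoc v (x 0))) (τ N (Fin.tail x))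
  headIns_eq_one : ∀ {p : ℕ} (f : MultilinearMap k (fun _ : Fin (p + 1) => A) U)
      (v : Fin p → A) (x : Fin 1 → A),
    headIns f v (τ 0 x) = f (Fin.snoc v (x 0))
  tailIns : ∀ {q : ℕ},
    (MultilinearMap k (fun _ : Fin (q + 1) => A) U) → (Fin q → A) → (U →ₗ[k] U)
  tailIns_eq : ∀ {q : ℕ} (g : MultilinearMap k (fun _ : Fin (q + 1) => A) U)
      (v : Fin q → A) {N : ℕ} (x : Fin (N + 2) → A),
    tailIns g v (τ (N + 1) x)
      = conc (τ N (Fin.init x)) (g (Fin.cons (x (Fin.last (N + 1))) v))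
  tailIns_eq_one : ∀ {q : ℕ} (g : MultilinearMap k (fun _ : Fin (q + 1) => A) U)
      (v : Fin q → A) (x : Fin 1 → A),
    tailIns g v (τ 0 x) = g (Fin.cons (x 0) v)
  vdash : ∀ {p q : ℕ},
    MultilinearMap k (fun _ : Fin (p + 2) => A) U →
    MultilinearMap k (fun _ : Fin (q + 2) => A) U →
    MultilinearMap k (fun _ : Fin (p + q + 3) => A) U
  vdash_eq : ∀ {p q : ℕ} (f : MultilinearMap k (fun _ : Fin (p + 2) => A) U)
      (g : MultilinearMap k (fun _ : Fin (q + 2) => A) U) (a : Fin (p + q + 3) → A),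
    vdash f g a
      = headIns f (fun i : Fin (p + 1) => a ⟨i.1, by have := i.2; omega⟩)
          (g (fun j : Fin (q + 2) => a ⟨p + 1 + j.1, by have := j.2; omega⟩))
  dashv : ∀ {p q : ℕ},
    MultilinearMap k (fun _ : Fin (p + 2) => A) U →
    MultilinearMap k (fun _ : Fin (q + 2) => A) U →
    MultilinearMap k (fun _ : Fin (p + q + 3) => A) U
  dashv_eq : ∀ {p q : ℕ} (f : MultilinearMap k (fun _ : Fin (p + 2) => A) U)
      (g : MultilinearMap k (fun _ : Fin (q + 2) => A) U) (a : Fin (p + q + 3) → A),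
    dashv f g a
      = tailIns g (fun j : Fin (q + 1) => a ⟨p + 2 + j.1, by have := j.2; omega⟩)
          (f (fun i : Fin (p + 2) => a ⟨i.1, by have := i.2; omega⟩))
  cup : ∀ {p q : ℕ},
    MultilinearMap k (fun _ : Fin (p + 1) => A) U →
    MultilinearMap k (fun _ : Fin (q + 1) => A) U →
    MultilinearMap k (fun _ : Fin (p + q + 2) => A) U
  cup_eq : ∀ {p q : ℕ} (f : MultilinearMap k (fun _ : Fin (p + 1) => A) U)
      (g : MultilinearMap k (fun _ : Fin (q + 1) => A) U) (a : Fin (p + q + 2) → A),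
    cup f g a
      = mrg (f (fun i : Fin (p + 1) => a ⟨i.1, by have := i.2; omega⟩))
          (g (fun j : Fin (q + 1) => a ⟨p + 1 + j.1, by have := j.2; omega⟩))
  hoch : ∀ {n : ℕ},
    MultilinearMap k (fun _ : Fin (n + 1) => A) U →
    MultilinearMap k (fun _ : Fin (n + 2) => A) U
  hoch_eq : ∀ {n : ℕ} (f : MultilinearMap k (fun _ : Fin (n + 1) => A) U)
      (a : Fin (n + 2) → A),
    hoch f a
      = mrg (τ 0 (fun _ => a 0)) (f (Fin.tail a))
        + (∑ i : Fin (n + 1), ((-1 : ℤ) ^ (i.1 + 1)) • f (mulArg a i))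
        + ((-1 : ℤ) ^ (n + 2)) • mrg (f (Fin.init a)) (τ 0 (fun _ => a (Fin.last (n + 1))))

attribute [instance] TensorTower.acg TensorTower.mod

namespace TensorTower

variable {k A : Type} [Field k] [Ring A] [Algebra k A] (T : TensorTower k A)

/-- The operation `f ∨ g = (f ⊢ g) − (f ⊣ g)` on Hochschild cochains. -/
def vee {p q : ℕ} (f : MultilinearMap k (fun _ : Fin (p + 2) => A) T.U)
    (g : MultilinearMap k (fun _ : Fin (q + 2) => A) T.U) :
    MultilinearMap k (fun _ : Fin (p + q + 3) => A) T.U :=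
  T.vdash f g - T.dashv f g

end TensorTower

namespace TensorTower

section Tuples

variable {A : Type}

lemma snoc_one (a x : A) : (Fin.snoc ![a] x : Fin 2 → A) = ![a, x] := by
  funext i; fin_cases i <;> rfl

lemma snoc_two (a b x : A) : (Fin.snoc ![a, b] x : Fin 3 → A) = ![a, b, x] := by
  funext i; fin_cases i <;> rfl

lemma cons_one (a x : A) : (Fin.cons x ![a] : Fin 2 → A) = ![x, a] := rfl

lemma cons_two (a b x : A) : (Fin.cons x ![a, b] : Fin 3 → A) = ![x, a, b] := rfl

lemma update_one_pair (a b x : A) : Function.update ![a, b] (1 : Fin 2) x = ![a, x] := by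
  funext i; fin_cases i <;> rfl

end Tuples

variable {k A : Type} [Field k] [Ring A] [Algebra k A] (T : TensorTower k A)

/-- The inclusion of `A` as the degree-one part of the tower. -/
def single (a : A) : T.U := T.τ 0 (fun _ => a)

lemma τ_congr {m m' : ℕ} (h : m = m') {x : Fin (m + 1) → A} {y : Fin (m' + 1) → A}
    (hxy : ∀ (i : ℕ) (h₁ : i < m + 1) (h₂ : i < m' + 1), x ⟨i, h₁⟩ = y ⟨i, h₂⟩) :
    T.τ m x = T.τ m' y := by
  subst h
  congr 1
  funext i
  exact hxy i.1 i.2 i.2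

lemma τ_zero (x : Fin 1 → A) : T.τ 0 x = T.single (x 0) := by
  unfold single
  congr 1
  funext i
  rw [Subsingleton.elim i 0]

lemma τ_succ_head {N : ℕ} (x : Fin (N + 2) → A) :
    T.τ (N + 1) x = T.conc (T.single (x 0)) (T.τ N (Fin.tail x)) := by
  rw [single, T.conc_eq]
  refine T.τ_congr (by omega) fun i h₁ h₂ => ?_
  unfold appendTuple Fin.tail
  rcases i with _ | i
  · simp
  · simp [Fin.succ]

lemma τ_succ_tail {N : ℕ} (x : Fin (N + 2) → A) :
    T.τ (N + 1) x = T.conc (T.τ N (Fin.init x)) (T.single (x (Fin.last (N + 1)))) := by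
  rw [single, T.conc_eq]
  refine T.τ_congr (by omega) fun i h₁ h₂ => ?_
  unfold appendTuple Fin.init
  split_ifs with h
  · rfl
  · congr 1
    ext
    simp only [Fin.val_last] at h ⊢
    omega

lemma eqOn_degree {V : Type} [AddCommGroup V] [Module k V] {φ ψ : T.U →ₗ[k] V} {m : ℕ}
    (h : ∀ x, φ (T.τ m x) = ψ (T.τ m x)) {u : T.U} (hu : u ∈ T.Tdeg (m + 1)) :
    φ u = ψ u := by
  have key : φ ∘ₗ (T.Tdeg (m + 1)).subtype ∘ₗ (T.model m).toLinearMap =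
      ψ ∘ₗ (T.Tdeg (m + 1)).subtype ∘ₗ (T.model m).toLinearMap := by
    refine PiTensorProduct.ext (MultilinearMap.ext fun x => ?_)
    simpa [T.model_eq] using h x
  simpa using LinearMap.congr_fun key ((T.model m).symm ⟨u, hu⟩)

lemma linearMap_ext {V : Type} [AddCommGroup V] [Module k V] {φ ψ : T.U →ₗ[k] V}
    (h : ∀ m x, φ (T.τ m x) = ψ (T.τ m x)) : φ = ψ := by
  have htop : ⨆ i, T.Tdeg i ≤ LinearMap.eqLocus φ ψ := by
    refine iSup_le fun i => ?_
    rcases i with _ | m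
    · rw [T.Tdeg_zero]
      exact bot_le
    · exact fun u hu => T.eqOn_degree (h m) hu
  rw [T.grading.submodule_iSup_eq_top] at htop
  exact LinearMap.ext fun u => htop (Submodule.mem_top : u ∈ ⊤)

lemma ext_head {V : Type} [AddCommGroup V] [Module k V] {φ ψ : T.U →ₗ[k] V}
    (h₁ : ∀ x, φ (T.single x) = ψ (T.single x))
    (h₂ : ∀ x w, φ (T.conc (T.single x) w) = ψ (T.conc (T.single x) w)) : φ = ψ := by
  refine T.linearMap_ext fun m x => ?_
  rcases m with _ | m
  · rw [T.τ_zero, h₁]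
  · rw [T.τ_succ_head, h₂]

lemma ext_tail {V : Type} [AddCommGroup V] [Module k V] {φ ψ : T.U →ₗ[k] V}
    (h₁ : ∀ x, φ (T.single x) = ψ (T.single x))
    (h₂ : ∀ x w, φ (T.conc w (T.single x)) = ψ (T.conc w (T.single x))) : φ = ψ := by
  refine T.linearMap_ext fun m x => ?_
  rcases m with _ | m
  · rw [T.τ_zero, h₁]
  · rw [T.τ_succ_tail, h₂]

lemma eqOn_head {V : Type} [AddCommGroup V] [Module k V] {φ ψ : T.U →ₗ[k] V} {m : ℕ}
    (h : ∀ x w, φ (T.conc (T.single x) w) = ψ (T.conc (T.single x) w))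
    {u : T.U} (hu : u ∈ T.Tdeg (m + 2)) : φ u = ψ u :=
  T.eqOn_degree (m := m + 1) (fun x => by rw [T.τ_succ_head, h]) hu

lemma eqOn_tail {V : Type} [AddCommGroup V] [Module k V] {φ ψ : T.U →ₗ[k] V} {m : ℕ}
    (h : ∀ x w, φ (T.conc w (T.single x)) = ψ (T.conc w (T.single x)))
    {u : T.U} (hu : u ∈ T.Tdeg (m + 2)) : φ u = ψ u :=
  T.eqOn_degree (m := m + 1) (fun x => by rw [T.τ_succ_tail, h]) hu

lemma assoc_of_eq_on_τ {B₁ B₂ B₃ B₄ : T.U →ₗ[k] T.U →ₗ[k] T.U}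
    (h : ∀ a b c x y z, B₁ (B₂ (T.τ a x) (T.τ b y)) (T.τ c z) =
      B₃ (T.τ a x) (B₄ (T.τ b y) (T.τ c z))) (u v w : T.U) :
    B₁ (B₂ u v) w = B₃ u (B₄ v w) := by
  have key : B₂.compr₂ B₁ = (LinearMap.llcomp k T.U T.U T.U ∘ₗ B₃).compl₂ B₄ :=
    T.linearMap_ext fun a x => T.linearMap_ext fun b y => T.linearMap_ext fun c z => by
      simpa using h a b c x y z
  simpa using LinearMap.congr_fun (LinearMap.congr_fun (LinearMap.congr_fun key u) v) w

lemma conc_assoc (u v w : T.U) : T.conc (T.conc u v) w = T.conc u (T.conc v w) := by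
  refine T.assoc_of_eq_on_τ (fun a b c x y z => ?_) u v w
  simp only [T.conc_eq]
  refine T.τ_congr (by omega) fun i h₁ h₂ => ?_
  unfold appendTuple
  grind

lemma mrg_conc_right (u v w : T.U) : T.mrg u (T.conc v w) = T.conc (T.mrg u v) w := by
  refine (T.assoc_of_eq_on_τ (fun a b c x y z => ?_) u v w).symm
  simp only [T.conc_eq, T.mrg_eq]
  refine T.τ_congr (by omega) fun i h₁ h₂ => ?_
  unfold appendTuple mergeTuple
  grind

lemma mrg_conc_left (u v w : T.U) : T.mrg (T.conc u v) w = T.conc u (T.mrg v w) := by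
  refine T.assoc_of_eq_on_τ (fun a b c x y z => ?_) u v w
  simp only [T.conc_eq, T.mrg_eq]
  refine T.τ_congr (by omega) fun i h₁ h₂ => ?_
  unfold appendTuple mergeTuple
  grind

lemma mrg_single_single (x y : A) : T.mrg (T.single x) (T.single y) = T.single (x * y) := by
  rw [single, single, T.mrg_eq, T.τ_zero]
  simp [mergeTuple]

lemma headIns_single {p : ℕ} (f : MultilinearMap k (fun _ : Fin (p + 1) => A) T.U)
    (v : Fin p → A) (x : A) :
    T.headIns f v (T.single x) = f (Fin.snoc v x) :=
  T.headIns_eq_one f v _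

lemma headIns_conc {p : ℕ} (f : MultilinearMap k (fun _ : Fin (p + 1) => A) T.U)
    (v : Fin p → A) (x : A) (w : T.U) :
    T.headIns f v (T.conc (T.single x) w) = T.conc (f (Fin.snoc v x)) w := by
  have key : T.headIns f v ∘ₗ T.conc (T.single x) = T.conc (f (Fin.snoc v x)) := by
    refine T.linearMap_ext fun m y => ?_
    have hy := T.τ_succ_head (Fin.cons x y : Fin (m + 2) → A)
    have hf := T.headIns_eq f v (Fin.cons x y : Fin (m + 2) → A)
    rw [hy] at hf
    simpa using hf
  exact LinearMap.congr_fun key w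

lemma tailIns_single {q : ℕ} (g : MultilinearMap k (fun _ : Fin (q + 1) => A) T.U)
    (v : Fin q → A) (x : A) :
    T.tailIns g v (T.single x) = g (Fin.cons x v) :=
  T.tailIns_eq_one g v _

lemma tailIns_conc {q : ℕ} (g : MultilinearMap k (fun _ : Fin (q + 1) => A) T.U)
    (v : Fin q → A) (w : T.U) (x : A) :
    T.tailIns g v (T.conc w (T.single x)) = T.conc w (g (Fin.cons x v)) := by
  have key : T.tailIns g v ∘ₗ T.conc.flip (T.single x) = T.conc.flip (g (Fin.cons x v)) := by
    refine T.linearMap_ext fun m y => ?_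
    have hy := T.τ_succ_tail (Fin.snoc y x : Fin (m + 2) → A)
    have hg := T.tailIns_eq g v (Fin.snoc y x : Fin (m + 2) → A)
    rw [hy] at hg
    simpa using hg
  exact LinearMap.congr_fun key w

lemma headIns_sum {p : ℕ} {ι : Type*} (s : Finset ι)
    (f : ι → MultilinearMap k (fun _ : Fin (p + 1) => A) T.U) (v : Fin p → A) :
    T.headIns (∑ i ∈ s, f i) v = ∑ i ∈ s, T.headIns (f i) v :=
  T.ext_head (fun x => by simp [headIns_single])
    (fun x w => by simp [headIns_conc])

lemma tailIns_sum {q : ℕ} {ι : Type*} (s : Finset ι)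
    (g : ι → MultilinearMap k (fun _ : Fin (q + 1) => A) T.U) (v : Fin q → A) :
    T.tailIns (∑ i ∈ s, g i) v = ∑ i ∈ s, T.tailIns (g i) v :=
  T.ext_tail (fun x => by simp [tailIns_single])
    (fun x w => by simp [tailIns_conc])

lemma sum_vee {p q : ℕ} {ι : Type*} (s : Finset ι)
    (f : ι → MultilinearMap k (fun _ : Fin (p + 2) => A) T.U)
    (g : MultilinearMap k (fun _ : Fin (q + 2) => A) T.U) :
    T.vee (∑ i ∈ s, f i) g = ∑ i ∈ s, T.vee (f i) g := by
  ext a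
  simp [vee, vdash_eq, dashv_eq, headIns_sum]

lemma vee_sum {p q : ℕ} {ι : Type*} (s : Finset ι)
    (f : MultilinearMap k (fun _ : Fin (p + 2) => A) T.U)
    (g : ι → MultilinearMap k (fun _ : Fin (q + 2) => A) T.U) :
    T.vee f (∑ i ∈ s, g i) = ∑ i ∈ s, T.vee f (g i) := by
  ext a
  simp [vee, vdash_eq, dashv_eq, tailIns_sum]

lemma hoch_sum {n : ℕ} {ι : Type*} (s : Finset ι)
    (f : ι → MultilinearMap k (fun _ : Fin (n + 1) => A) T.U) :
    T.hoch (∑ i ∈ s, f i) = ∑ i ∈ s, T.hoch (f i) := by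
  ext a
  simp only [hoch_eq, sum_apply, map_sum, LinearMap.sum_apply,
    Finset.sum_add_distrib, Finset.smul_sum]
  rw [Finset.sum_comm]

lemma hoch_apply_three (f : MultilinearMap k (fun _ : Fin 2 => A) T.U) (a b c : A) :
    T.hoch (n := 1) f ![a, b, c] = T.mrg (T.single a) (f ![b, c]) - f ![a * b, c]
      + f ![a, b * c] - T.mrg (f ![a, b]) (T.single c) := by
  have h₀ : mulArg (n := 1) ![a, b, c] 0 = ![a * b, c] := by
    funext i; fin_cases i <;> rfl
  have h₁ : mulArg (n := 1) ![a, b, c] 1 = ![a, b * c] := by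
    funext i; fin_cases i <;> rfl
  have h₂ : (Fin.init ![a, b, c] : Fin 2 → A) = ![a, b] := by
    funext i; fin_cases i <;> rfl
  have h₃ : (Fin.tail ![a, b, c] : Fin 2 → A) = ![b, c] := rfl
  have h₄ : (![a, b, c] : Fin 3 → A) (Fin.last (1 + 1)) = c := rfl
  rw [T.hoch_eq, Fin.sum_univ_two, h₀, h₁, h₂, h₃, h₄]
  simp [single]
  abel

lemma hoch_apply_four (f : MultilinearMap k (fun _ : Fin 3 => A) T.U) (a b c d : A) :
    T.hoch (n := 2) f ![a, b, c, d] = T.mrg (T.single a) (f ![b, c, d]) - f ![a * b, c, d]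
      + f ![a, b * c, d] - f ![a, b, c * d] + T.mrg (f ![a, b, c]) (T.single d) := by
  have h₀ : mulArg (n := 2) ![a, b, c, d] 0 = ![a * b, c, d] := by
    funext i; fin_cases i <;> rfl
  have h₁ : mulArg (n := 2) ![a, b, c, d] 1 = ![a, b * c, d] := by
    funext i; fin_cases i <;> rfl
  have h₂ : mulArg (n := 2) ![a, b, c, d] 2 = ![a, b, c * d] := by
    funext i; fin_cases i <;> rfl
  have h₃ : (Fin.init ![a, b, c, d] : Fin 3 → A) = ![a, b, c] := by
    funext i; fin_cases i <;> rfl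
  have h₄ : (Fin.tail ![a, b, c, d] : Fin 3 → A) = ![b, c, d] := rfl
  have h₅ : (![a, b, c, d] : Fin 4 → A) (Fin.last (2 + 1)) = d := rfl
  rw [T.hoch_eq, Fin.sum_univ_three, h₀, h₁, h₂, h₃, h₄, h₅]
  simp [single]
  abel

lemma vee_apply_three (f g : MultilinearMap k (fun _ : Fin 2 => A) T.U) (a b c : A) :
    T.vee (p := 0) (q := 0) f g ![a, b, c] =
      T.headIns (p := 1) f ![a] (g ![b, c]) - T.tailIns (q := 1) g ![c] (f ![a, b]) := by
  rw [vee, _root_.sub_apply, T.vdash_eq, T.dashv_eq]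
  congr <;> funext i <;> fin_cases i <;> rfl

lemma vee_apply_four_left (F : MultilinearMap k (fun _ : Fin 3 => A) T.U)
    (g : MultilinearMap k (fun _ : Fin 2 => A) T.U) (a b c d : A) :
    T.vee (p := 1) (q := 0) F g ![a, b, c, d] =
      T.headIns (p := 2) F ![a, b] (g ![c, d]) - T.tailIns (q := 1) g ![d] (F ![a, b, c]) := by
  rw [vee, _root_.sub_apply, T.vdash_eq, T.dashv_eq]
  congr <;> funext i <;> fin_cases i <;> rfl

lemma vee_apply_four_right (f : MultilinearMap k (fun _ : Fin 2 => A) T.U)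
    (G : MultilinearMap k (fun _ : Fin 3 => A) T.U) (a b c d : A) :
    T.vee (p := 0) (q := 1) f G ![a, b, c, d] =
      T.headIns (p := 1) f ![a] (G ![b, c, d]) - T.tailIns (q := 2) G ![c, d] (f ![a, b]) := by
  rw [vee, _root_.sub_apply, T.vdash_eq, T.dashv_eq]
  congr <;> funext i <;> fin_cases i <;> rfl

/-- Right multiplication commutes with insertion in the head, in degrees at least two. -/
lemma headIns_mrg_single {p : ℕ} (f : MultilinearMap k (fun _ : Fin (p + 1) => A) T.U)
    (v : Fin p → A) (d : A) {m : ℕ} {u : T.U} (hu : u ∈ T.Tdeg (m + 2)) :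
    T.headIns f v (T.mrg u (T.single d)) = T.mrg (T.headIns f v u) (T.single d) := by
  have := T.eqOn_head (φ := T.headIns f v ∘ₗ T.mrg.flip (T.single d))
    (ψ := T.mrg.flip (T.single d) ∘ₗ T.headIns f v)
    (fun x w => by simp [mrg_conc_left, headIns_conc]) hu
  simpa using this

/-- Left multiplication commutes with insertion in the tail, in degrees at least two. -/
lemma tailIns_mrg_single {q : ℕ} (g : MultilinearMap k (fun _ : Fin (q + 1) => A) T.U)
    (v : Fin q → A) (a : A) {m : ℕ} {u : T.U} (hu : u ∈ T.Tdeg (m + 2)) :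
    T.tailIns g v (T.mrg (T.single a) u) = T.mrg (T.single a) (T.tailIns g v u) := by
  have := T.eqOn_tail (φ := T.tailIns g v ∘ₗ T.mrg (T.single a))
    (ψ := T.mrg (T.single a) ∘ₗ T.tailIns g v)
    (fun x w => by simp [mrg_conc_right, tailIns_conc]) hu
  simpa using this

lemma headIns_conc_left {p : ℕ} (f : MultilinearMap k (fun _ : Fin (p + 1) => A) T.U)
    (v : Fin p → A) (u w : T.U) :
    T.headIns f v (T.conc u w) = T.conc (T.headIns f v u) w := by
  have := T.ext_head (φ := T.headIns f v ∘ₗ T.conc.flip w)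
    (ψ := T.conc.flip w ∘ₗ T.headIns f v)
    (fun x => by simp [headIns_conc, headIns_single])
    (fun x w => by simp [headIns_conc, conc_assoc])
  simpa using LinearMap.congr_fun this u

lemma tailIns_conc_right {q : ℕ} (g : MultilinearMap k (fun _ : Fin (q + 1) => A) T.U)
    (v : Fin q → A) (u w : T.U) :
    T.tailIns g v (T.conc w u) = T.conc w (T.tailIns g v u) := by
  have := T.ext_tail (φ := T.tailIns g v ∘ₗ T.conc w) (ψ := T.conc w ∘ₗ T.tailIns g v)
    (fun x => by simp [tailIns_conc, tailIns_single])
    (fun x w => by simp [tailIns_conc, ← conc_assoc])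
  simpa using LinearMap.congr_fun this u

/-- Insertion in the head commutes with insertion in the tail, in degrees at least two. -/
lemma headIns_tailIns {p q : ℕ} (f : MultilinearMap k (fun _ : Fin (p + 1) => A) T.U)
    (h : MultilinearMap k (fun _ : Fin (q + 1) => A) T.U)
    (v : Fin p → A) (w : Fin q → A) {m : ℕ} {u : T.U} (hu : u ∈ T.Tdeg (m + 2)) :
    T.headIns f v (T.tailIns h w u) = T.tailIns h w (T.headIns f v u) := by
  have := T.eqOn_head (φ := T.headIns f v ∘ₗ T.tailIns h w)
    (ψ := T.tailIns h w ∘ₗ T.headIns f v)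
    (fun x w => by simp [headIns_conc, tailIns_conc_right]) hu
  simpa using this

lemma headIns_hoch (f : MultilinearMap k (fun _ : Fin 2 => A) T.U) (a b : A) (u : T.U) :
    T.headIns (p := 2) (T.hoch (n := 1) f) ![a, b] u =
      T.mrg (T.single a) (T.headIns (p := 1) f ![b] u) - T.headIns (p := 1) f ![a * b] u
        + T.headIns (p := 1) f ![a] (T.mrg (T.single b) u) - T.mrg (f ![a, b]) u := by
  have := T.ext_head (φ := T.headIns (p := 2) (T.hoch (n := 1) f) ![a, b])
    (ψ := T.mrg (T.single a) ∘ₗ T.headIns (p := 1) f ![b] - T.headIns (p := 1) f ![a * b]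
        + T.headIns (p := 1) f ![a] ∘ₗ T.mrg (T.single b) - T.mrg (f ![a, b]))
    (fun x => by
      simp only [LinearMap.sub_apply, LinearMap.add_apply, LinearMap.comp_apply, headIns_single,
        mrg_single_single, snoc_one, snoc_two, hoch_apply_three])
    (fun x w => by
      simp only [LinearMap.sub_apply, LinearMap.add_apply, LinearMap.comp_apply, headIns_conc,
        mrg_conc_right, mrg_single_single, snoc_one, snoc_two, hoch_apply_three, map_sub, map_add])
  simpa using LinearMap.congr_fun this u

lemma tailIns_hoch (g : MultilinearMap k (fun _ : Fin 2 => A) T.U) (c d : A) (u : T.U) :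
    T.tailIns (q := 2) (T.hoch (n := 1) g) ![c, d] u =
      T.mrg u (g ![c, d]) - T.tailIns (q := 1) g ![d] (T.mrg u (T.single c))
        + T.tailIns (q := 1) g ![c * d] u - T.mrg (T.tailIns (q := 1) g ![c] u) (T.single d) := by
  have := T.ext_tail (φ := T.tailIns (q := 2) (T.hoch (n := 1) g) ![c, d])
    (ψ := T.mrg.flip (g ![c, d]) - T.tailIns (q := 1) g ![d] ∘ₗ T.mrg.flip (T.single c)
        + T.tailIns (q := 1) g ![c * d] - T.mrg.flip (T.single d) ∘ₗ T.tailIns (q := 1) g ![c])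
    (fun x => by
      simp only [LinearMap.sub_apply, LinearMap.add_apply, LinearMap.comp_apply,
        LinearMap.flip_apply, tailIns_single, mrg_single_single, cons_one, cons_two,
        hoch_apply_three])
    (fun x w => by
      simp only [LinearMap.sub_apply, LinearMap.add_apply, LinearMap.comp_apply,
        LinearMap.flip_apply, tailIns_conc, mrg_conc_left, mrg_single_single, cons_one, cons_two,
        hoch_apply_three, map_sub, map_add])
  simpa using LinearMap.congr_fun this u

lemma hoch_vee (f g : MultilinearMap k (fun _ : Fin 2 => A) T.U)
    (hf : ∀ x, ∃ m, f x ∈ T.Tdeg (m + 2)) (hg : ∀ x, ∃ m, g x ∈ T.Tdeg (m + 2)) :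
    T.hoch (T.vee (p := 0) (q := 0) f g) =
      T.vee (p := 1) (q := 0) (T.hoch f) g - T.vee (p := 0) (q := 1) f (T.hoch g) := by
  refine MultilinearMap.ext fun x => ?_
  obtain ⟨a, b, c, d, rfl⟩ : ∃ a b c d : A, x = ![a, b, c, d] :=
    ⟨x 0, x 1, x 2, x 3, by funext i; fin_cases i <;> rfl⟩
  obtain ⟨m, hm⟩ := hf ![b, c]
  obtain ⟨m', hm'⟩ := hg ![b, c]
  refine (T.hoch_apply_four _ a b c d).trans ?_
  rw [_root_.sub_apply, T.vee_apply_four_left, T.vee_apply_four_right]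
  simp only [vee_apply_three, hoch_apply_three, headIns_hoch, tailIns_hoch, map_sub, map_add,
    LinearMap.sub_apply, T.headIns_mrg_single _ _ _ hm', T.tailIns_mrg_single _ _ _ hm]
  abel

lemma tailIns_add_arg (g : MultilinearMap k (fun _ : Fin 2 => A) T.U) (x y : A) :
    T.tailIns (q := 1) g ![x + y] = T.tailIns (q := 1) g ![x] + T.tailIns (q := 1) g ![y] := by
  have hg : ∀ z, g ![z, x + y] = g ![z, x] + g ![z, y] := fun z => by
    simpa only [update_one_pair] using g.map_update_add ![z, 0] 1 x y
  exact T.ext_tail (fun z => by simp [tailIns_single, hg])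
    (fun z w => by simp [tailIns_conc, hg])

lemma tailIns_smul_arg (g : MultilinearMap k (fun _ : Fin 2 => A) T.U) (r : k) (x : A) :
    T.tailIns (q := 1) g ![r • x] = r • T.tailIns (q := 1) g ![x] := by
  have hg : ∀ z, g ![z, r • x] = r • g ![z, x] := fun z => by
    simpa only [update_one_pair] using g.map_update_smul ![z, 0] 1 r x
  exact T.ext_tail (fun z => by simp [tailIns_single, hg])
    (fun z w => by simp [tailIns_conc, hg])

/-- The map `x ↦ g^{[m,m+1]}(u₁⊗⋯⊗u_m⊗x)` as a one-variable cochain. -/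
def tailCochain (g : MultilinearMap k (fun _ : Fin 2 => A) T.U) (u : T.U) :
    MultilinearMap k (fun _ : Fin 1 => A) T.U :=
  MultilinearMap.ofSubsingleton k A T.U (0 : Fin 1)
    { toFun := fun x => T.tailIns (q := 1) g ![x] u
      map_add' := fun x y => by rw [tailIns_add_arg, LinearMap.add_apply]
      map_smul' := fun r x => by rw [tailIns_smul_arg, LinearMap.smul_apply, RingHom.id_apply] }

lemma tailCochain_apply (g : MultilinearMap k (fun _ : Fin 2 => A) T.U) (u : T.U)
    (x : Fin 1 → A) : T.tailCochain g u x = T.tailIns (q := 1) g ![x 0] u := rfl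

/-- Apply `g` across the junction of `u` and `w`: the last component of `u` and the first
component of `w` are its arguments. -/
def junction (g : MultilinearMap k (fun _ : Fin 2 => A) T.U) : T.U →ₗ[k] T.U →ₗ[k] T.U where
  toFun u := T.headIns (p := 0) (T.tailCochain g u) ![]
  map_add' u v := T.ext_head
    (fun x => by simp [headIns_single, tailCochain_apply])
    (fun x w => by simp [headIns_conc, tailCochain_apply])
  map_smul' r u := T.ext_head
    (fun x => by simp [headIns_single, tailCochain_apply])
    (fun x w => by simp [headIns_conc, tailCochain_apply])

lemma junction_single_right (g : MultilinearMap k (fun _ : Fin 2 => A) T.U) (u : T.U) (x : A) :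
    T.junction g u (T.single x) = T.tailIns (q := 1) g ![x] u :=
  T.headIns_single (p := 0) _ _ _

lemma junction_conc_right (g : MultilinearMap k (fun _ : Fin 2 => A) T.U) (u w : T.U) (x : A) :
    T.junction g u (T.conc (T.single x) w) = T.conc (T.tailIns (q := 1) g ![x] u) w :=
  T.headIns_conc (p := 0) _ _ _ _

lemma junction_single_left (g : MultilinearMap k (fun _ : Fin 2 => A) T.U) (w : T.U) (y : A) :
    T.junction g (T.single y) w = T.headIns (p := 1) g ![y] w :=
  LinearMap.congr_fun (T.ext_head
    (fun x => by
      rw [junction_single_right, headIns_single, tailIns_single, snoc_one, cons_one])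
    (fun x w => by
      rw [junction_conc_right, headIns_conc, tailIns_single, snoc_one, cons_one])) w

lemma junction_conc_left (g : MultilinearMap k (fun _ : Fin 2 => A) T.U) (u w : T.U) (y : A) :
    T.junction g (T.conc u (T.single y)) w = T.conc u (T.headIns (p := 1) g ![y] w) :=
  LinearMap.congr_fun (T.ext_head (ψ := T.conc u ∘ₗ T.headIns (p := 1) g ![y])
    (fun x => by
      rw [junction_single_right, LinearMap.comp_apply, headIns_single, tailIns_conc, snoc_one,
        cons_one])
    (fun x w => by
      rw [junction_conc_right, LinearMap.comp_apply, headIns_conc, tailIns_conc, snoc_one,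
        cons_one, conc_assoc])) w

lemma headIns_vee (f g : MultilinearMap k (fun _ : Fin 2 => A) T.U) (a b : A) (u : T.U) :
    T.headIns (p := 2) (T.vee (p := 0) (q := 0) f g) ![a, b] u =
      T.headIns (p := 1) f ![a] (T.headIns (p := 1) g ![b] u) - T.junction g (f ![a, b]) u := by
  have := T.ext_head (φ := T.headIns (p := 2) (T.vee (p := 0) (q := 0) f g) ![a, b])
    (ψ := T.headIns (p := 1) f ![a] ∘ₗ T.headIns (p := 1) g ![b] - T.junction g (f ![a, b]))
    (fun x => by
      simp only [LinearMap.sub_apply, LinearMap.comp_apply, headIns_single, snoc_one, snoc_two,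
        vee_apply_three, junction_single_right])
    (fun x w => by
      simp only [LinearMap.sub_apply, LinearMap.comp_apply, headIns_single, headIns_conc_left,
        snoc_one, snoc_two, vee_apply_three, junction_conc_right, map_sub])
  exact LinearMap.congr_fun this u

lemma tailIns_vee (g h : MultilinearMap k (fun _ : Fin 2 => A) T.U) (c d : A) (u : T.U) :
    T.tailIns (q := 2) (T.vee (p := 0) (q := 0) g h) ![c, d] u =
      T.junction g u (h ![c, d]) - T.tailIns (q := 1) h ![d] (T.tailIns (q := 1) g ![c] u) := by
  have := T.ext_tail (φ := T.tailIns (q := 2) (T.vee (p := 0) (q := 0) g h) ![c, d])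
    (ψ := (T.junction g).flip (h ![c, d]) -
      T.tailIns (q := 1) h ![d] ∘ₗ T.tailIns (q := 1) g ![c])
    (fun x => by
      simp only [LinearMap.sub_apply, LinearMap.comp_apply, LinearMap.flip_apply, tailIns_single,
        cons_one, cons_two, vee_apply_three, junction_single_left])
    (fun x w => by
      simp only [LinearMap.sub_apply, LinearMap.comp_apply, LinearMap.flip_apply, tailIns_single,
        tailIns_conc_right, cons_one, cons_two, vee_apply_three, junction_conc_left, map_sub])
  exact LinearMap.congr_fun this u

lemma vee_assoc (f g h : MultilinearMap k (fun _ : Fin 2 => A) T.U)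
    (hg : ∀ x, ∃ m, g x ∈ T.Tdeg (m + 2)) :
    T.vee (p := 1) (q := 0) (T.vee (p := 0) (q := 0) f g) h =
      T.vee (p := 0) (q := 1) f (T.vee (p := 0) (q := 0) g h) := by
  refine MultilinearMap.ext fun x => ?_
  obtain ⟨a, b, c, d, rfl⟩ : ∃ a b c d : A, x = ![a, b, c, d] :=
    ⟨x 0, x 1, x 2, x 3, by funext i; fin_cases i <;> rfl⟩
  obtain ⟨m, hm⟩ := hg ![b, c]
  refine (T.vee_apply_four_left _ h a b c d).trans
    (Eq.trans ?_ (T.vee_apply_four_right f _ a b c d).symm)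
  simp only [vee_apply_three, headIns_vee, tailIns_vee, map_sub, T.headIns_tailIns _ _ _ _ hm]
  abel

end TensorTower

/-- Let `n ≥ 1` and let `β⁽ⁱ⁾ ∈ C²(A, A^{⊗(i+1)})` for `1 ≤ i ≤ n`
satisfy, for every `1 ≤ m ≤ n`, the truncated Maurer–Cartan equation
`b(β⁽ᵐ⁾) = Σ_{i+j=m, i,j≥1} β⁽ⁱ⁾ ∨ β⁽ʲ⁾`.  Then the next obstruction
`Σ_{i+j=n+1, i,j≥1} β⁽ⁱ⁾ ∨ β⁽ʲ⁾ ∈ C³(A, A^{⊗(n+2)})` is a Hochschild 3-cocycle. -/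
theorem maurer_cartan_obstruction_is_cocycle
    {k A : Type} [Field k] [CharZero k] [Ring A] [Algebra k A]
    (T : TensorTower k A) (n : ℕ) (hn : 1 ≤ n)
    (β : ℕ → MultilinearMap k (fun _ : Fin 2 => A) T.U)
    (hβdeg : ∀ i, 1 ≤ i → ∀ x, β i x ∈ T.Tdeg (i + 1))
    (hMC : ∀ m, 1 ≤ m → m ≤ n →
      T.hoch (β m) = ∑ i ∈ Finset.Icc 1 (m - 1), T.vee (β i) (β (m - i))) :
    T.hoch (∑ i ∈ Finset.Icc 1 n, T.vee (β i) (β (n + 1 - i))) = 0 := by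
  rw [T.hoch_sum]
  have hdeg : ∀ i, 1 ≤ i → ∀ x, ∃ m, β i x ∈ T.Tdeg (m + 2) := fun i hi x =>
    ⟨i - 1, by simpa only [show i - 1 + 2 = i + 1 by omega] using hβdeg i hi x⟩
  have hstep : ∀ i ∈ Finset.Icc 1 n, T.hoch (T.vee (β i) (β (n + 1 - i))) =
      (∑ j ∈ Finset.Icc 1 (i - 1),
        T.vee (p := 1) (q := 0) (T.vee (β j) (β (i - j))) (β (n + 1 - i))) -
      ∑ j ∈ Finset.Icc 1 (n + 1 - i - 1),
        T.vee (p := 0) (q := 1) (β i) (T.vee (β j) (β (n + 1 - i - j))) := by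
    intro i hi
    rw [Finset.mem_Icc] at hi
    rw [T.hoch_vee _ _ (hdeg i hi.1) (hdeg (n + 1 - i) (by omega)), hMC i hi.1 hi.2,
      hMC (n + 1 - i) (by omega) (by omega), T.sum_vee, T.vee_sum]
  rw [Finset.sum_congr rfl hstep, Finset.sum_sub_distrib, sub_eq_zero,
    Finset.sum_sigma', Finset.sum_sigma']
  refine Finset.sum_bij' (fun p _ => ⟨p.2, p.1 - p.2⟩) (fun p _ => ⟨p.1 + p.2, p.1⟩)
    ?_ ?_ ?_ ?_ ?_
  · rintro ⟨i, j⟩ h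
    simp only [Finset.mem_sigma, Finset.mem_Icc] at h ⊢
    omega
  · rintro ⟨i, j⟩ h
    simp only [Finset.mem_sigma, Finset.mem_Icc] at h ⊢
    omega
  · rintro ⟨i, j⟩ h
    simp only [Finset.mem_sigma, Finset.mem_Icc] at h
    simp only [Sigma.mk.injEq, heq_eq_eq, and_true]
    omega
  · rintro ⟨i, j⟩ h
    simp only [Finset.mem_sigma, Finset.mem_Icc] at h
    simp only [Sigma.mk.injEq, heq_eq_eq, true_and]
    omega
  · rintro ⟨i, j⟩ h
    simp only [Finset.mem_sigma, Finset.mem_Icc] at h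
    simp only [show n + 1 - j - (i - j) = n + 1 - i by omega]
    exact T.vee_assoc _ _ _ (hdeg (i - j) (by omega))
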